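/- Let g = (V,μ) and g' = (V,μ') be finite-dimensional real Lie algebras on the same space V, with Betti numbers b_i(g) = dim H^i(g,ℝ). If the polynomial P_T(g') − P_T(g) = Σ_{i=1}^{dim V} (b_i(g') − b_i(g)) T^i has at least one negative coefficient, then there is no plateau deformation from g' to g, i.e. there is no family of Lie brackets μ_t on V, t ∈ [0,1], with t ↦ μ_t(X,Y) continuous for all X,Y, μ_0 = μ', (V,μ_t) isomorphic to (V,μ) for all t ∈ (0,1], and (V,μ') not isomorphic to (V,μ). -/

import Mathlib

open Filter Topology Set

/-- A Lie bracket on a real vector space `V`: a bilinear alternating map satisfying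
the Jacobi identity. -/
structure LieBracketOn (V : Type) [AddCommGroup V] [Module ℝ V] : Type where
  br : V →ₗ[ℝ] V →ₗ[ℝ] V
  alt : ∀ x : V, br x x = 0
  jacobi : ∀ x y z : V, br x (br y z) + br y (br z x) + br z (br x y) = 0

variable {V : Type} [NormedAddCommGroup V] [NormedSpace ℝ V]

/-- `g = (V,μ)` contracts onto `g' = (V,μ')`: there is a family `Φ_t` of linear
automorphisms of `V` such that `Φ_t⁻¹ (μ (Φ_t X) (Φ_t Y)) → μ' X Y` as `t → ∞`. -/
def Contracts (μ μ' : LieBracketOn V) : Prop :=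
  ∃ Φ : ℝ → (V ≃ₗ[ℝ] V), ∀ X Y : V,
    Tendsto (fun t : ℝ => (Φ t).symm (μ.br (Φ t X) (Φ t Y))) atTop (𝓝 (μ'.br X Y))

/-- `(V,μ)` and `(V,μ')` are isomorphic as Lie algebras. -/
def BrIso (μ μ' : LieBracketOn V) : Prop :=
  ∃ e : V ≃ₗ[ℝ] V, ∀ x y : V, e (μ.br x y) = μ'.br (e x) (e y)

/-- `μt` is a deformation of plateau type from `g' = (V,μ')` to `g = (V,μ)`:
`t ↦ μ_t(X,Y)` is continuous on `[0,1]`, `μ_0 = μ'`, `(V,μ_t) ≃ (V,μ)` for all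
`t ∈ (0,1]`, and `(V,μ') ≄ (V,μ)`. -/
def IsPlateauDeformation (μ' μ : LieBracketOn V) (μt : ℝ → LieBracketOn V) : Prop :=
  (∀ X Y : V, ContinuousOn (fun t => (μt t).br X Y) (Icc (0:ℝ) 1)) ∧
  μt 0 = μ' ∧ (∀ t ∈ Ioc (0:ℝ) 1, BrIso (μt t) μ) ∧ ¬ BrIso μ' μ

open Filter Topology Set

namespace CE

variable {V W : Type} [AddCommGroup V] [Module ℝ V] [AddCommGroup W] [Module ℝ W]

/-- The Chevalley–Eilenberg coboundary of a `p`-cochain `Φ` (an alternating `p`-linear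
map `V^p → W`), relative to a bracket `br` on `V` and an action `ρ` of `V` on `W`,
evaluated on a `(p+1)`-tuple `X` (indices `0,…,p` correspond to `X_1,…,X_{p+1}`):
`dΦ(X_0,…,X_p) = Σ_s (−1)^s ρ(X_s)(Φ(…,X̂_s,…))
  + Σ_{s<t} (−1)^{s+t} Φ(br(X_s,X_t),…,X̂_s,…,X̂_t,…)`. -/
def ceDfun (br : V →ₗ[ℝ] V →ₗ[ℝ] V) (ρ : V →ₗ[ℝ] W →ₗ[ℝ] W) {p : ℕ}
    (Φ : V [⋀^Fin p]→ₗ[ℝ] W) (X : Fin (p + 1) → V) : W :=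
  (∑ s : Fin (p + 1), ((-1 : ℝ) ^ (s : ℕ)) • ρ (X s) (Φ (X ∘ s.succAbove)))
  + ∑ s : Fin (p + 1), ∑ t : Fin (p + 1),
      if (s : ℕ) < (t : ℕ) then
        ((-1 : ℝ) ^ ((s : ℕ) + (t : ℕ))) • Φ (fun i : Fin p =>
          if (i : ℕ) = 0 then br (X s) (X t)
          else if (i : ℕ) - 1 < (s : ℕ) then X ⟨(i : ℕ) - 1, by have := i.isLt; omega⟩
          else if (i : ℕ) < (t : ℕ) then X ⟨(i : ℕ), by have := i.isLt; omega⟩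
          else X ⟨(i : ℕ) + 1, by have := i.isLt; omega⟩)
      else 0

/-- The Chevalley–Eilenberg coboundary, as a linear map into functions. -/
def ceD (br : V →ₗ[ℝ] V →ₗ[ℝ] V) (ρ : V →ₗ[ℝ] W →ₗ[ℝ] W) (p : ℕ) :
    (V [⋀^Fin p]→ₗ[ℝ] W) →ₗ[ℝ] ((Fin (p + 1) → V) → W) where
  toFun Φ := ceDfun br ρ Φ
  map_add' Φ Ψ := by
    have key : ∀ {c : Prop} [Decidable c] (a b : W),
        (if c then a + b else 0) = (if c then a else 0) + (if c then b else 0) := by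
      intro c _ a b; split <;> simp
    funext X
    simp only [ceDfun, AlternatingMap.add_apply, map_add, smul_add, Pi.add_apply,
      key, Finset.sum_add_distrib]
    abel
  map_smul' c Φ := by
    funext X
    simp only [ceDfun, AlternatingMap.smul_apply, map_smul, RingHom.id_apply, Pi.smul_apply,
      smul_add, Finset.smul_sum, smul_ite, smul_zero, smul_smul, mul_comm]

/-- Evaluation of an alternating map as a plain function, as a linear map. -/
def altEval (q : ℕ) : (V [⋀^Fin q]→ₗ[ℝ] W) →ₗ[ℝ] ((Fin q → V) → W) where
  toFun Ψ := ⇑Ψ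
  map_add' a b := by funext X; simp
  map_smul' c a := by funext X; simp

/-- The space `Z^p` of `p`-cocycles. -/
def ceZ (br : V →ₗ[ℝ] V →ₗ[ℝ] V) (ρ : V →ₗ[ℝ] W →ₗ[ℝ] W) (p : ℕ) :
    Submodule ℝ (V [⋀^Fin p]→ₗ[ℝ] W) :=
  LinearMap.ker (ceD br ρ p)

/-- The space `B^p` of `p`-coboundaries (`B^0 = 0`). -/
def ceB (br : V →ₗ[ℝ] V →ₗ[ℝ] V) (ρ : V →ₗ[ℝ] W →ₗ[ℝ] W) :
    (p : ℕ) → Submodule ℝ (V [⋀^Fin p]→ₗ[ℝ] W)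
  | 0 => ⊥
  | (p + 1) => Submodule.comap (altEval (p + 1)) (LinearMap.range (ceD br ρ p))

/-- The `p`-th Chevalley–Eilenberg cohomology space `H^p = Z^p / B^p`. -/
def CEH (br : V →ₗ[ℝ] V →ₗ[ℝ] V) (ρ : V →ₗ[ℝ] W →ₗ[ℝ] W) (p : ℕ) : Type :=
  ceZ br ρ p ⧸ Submodule.comap (ceZ br ρ p).subtype (ceB br ρ p)

noncomputable instance (br : V →ₗ[ℝ] V →ₗ[ℝ] V) (ρ : V →ₗ[ℝ] W →ₗ[ℝ] W) (p : ℕ) :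
    AddCommGroup (CEH br ρ p) :=
  inferInstanceAs (AddCommGroup (ceZ br ρ p ⧸ Submodule.comap (ceZ br ρ p).subtype (ceB br ρ p)))

noncomputable instance (br : V →ₗ[ℝ] V →ₗ[ℝ] V) (ρ : V →ₗ[ℝ] W →ₗ[ℝ] W) (p : ℕ) :
    Module ℝ (CEH br ρ p) :=
  inferInstanceAs (Module ℝ (ceZ br ρ p ⧸ Submodule.comap (ceZ br ρ p).subtype (ceB br ρ p)))

/-- `dim H^p`. -/
noncomputable def Hdim (br : V →ₗ[ℝ] V →ₗ[ℝ] V) (ρ : V →ₗ[ℝ] W →ₗ[ℝ] W) (p : ℕ) : ℕ :=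
  Module.finrank ℝ (CEH br ρ p)

section CartanCalculus

open AlternatingMap

variable {n : ℕ} (br : V →ₗ[ℝ] V →ₗ[ℝ] V)

/-- Contraction of a cochain by a vector, as a bilinear map. -/
def contract (n : ℕ) : V →ₗ[ℝ] (V [⋀^Fin (n + 1)]→ₗ[ℝ] ℝ) →ₗ[ℝ] (V [⋀^Fin n]→ₗ[ℝ] ℝ) :=
  (curryLeftLinearMap (R := ℝ) (M := V) (N := ℝ) (n := n)).flip

/-- The Lie derivative of cochains with trivial coefficients (the coadjoint action). -/
def lieDeriv : (n : ℕ) → V →ₗ[ℝ] (V [⋀^Fin n]→ₗ[ℝ] ℝ) →ₗ[ℝ] (V [⋀^Fin n]→ₗ[ℝ] ℝ)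
  | 0 => 0
  | n + 1 => LinearMap.mk₂ ℝ
      (fun x Φ => -alternatizeUncurryFin ((contract n).flip Φ ∘ₗ br x))
      (fun x y Φ => by
        simp [LinearMap.comp_add, add_comm])
      (fun c x Φ => by
        simp [LinearMap.comp_smul])
      (fun x Φ Ψ => by
        simp [LinearMap.add_comp, add_comm])
      (fun c x Φ => by
        simp [LinearMap.smul_comp])

/-- The Chevalley–Eilenberg differential with trivial coefficients, with values in
alternating maps. -/
noncomputable def ceDiff (n : ℕ) :
    (V [⋀^Fin n]→ₗ[ℝ] ℝ) →ₗ[ℝ] (V [⋀^Fin (n + 1)]→ₗ[ℝ] ℝ) :=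
  (1 / 2 : ℝ) • (alternatizeUncurryFinLM ∘ₗ (lieDeriv br n).flip)

theorem alternatizeUncurryFin_neg (f : V →ₗ[ℝ] V [⋀^Fin n]→ₗ[ℝ] ℝ) :
    alternatizeUncurryFin (-f) = -alternatizeUncurryFin f :=
  map_neg alternatizeUncurryFinLM f

theorem contract_alternatizeUncurryFin (f : V →ₗ[ℝ] V [⋀^Fin (n + 1)]→ₗ[ℝ] ℝ) (x : V) :
    contract (n + 1) x (alternatizeUncurryFin f)
      = f x - alternatizeUncurryFin (contract n x ∘ₗ f) := by
  ext v
  have h : ∀ i : Fin (n + 1), i.succ.removeNth (Matrix.vecCons x v)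
      = Matrix.vecCons x (i.removeNth v) := by
    intro i
    ext j
    refine Fin.cases ?_ (fun j => ?_) j <;> simp [Fin.removeNth, Matrix.vecCons]
  simp [contract, alternatizeUncurryFin_apply, Fin.sum_univ_succ, h, pow_succ, sub_eq_add_neg]

theorem contract_swap (x y : V) (Φ : V [⋀^Fin (n + 2)]→ₗ[ℝ] ℝ) :
    contract n x (contract (n + 1) y Φ) = -contract n y (contract (n + 1) x Φ) := by
  have h := curryLeft_same Φ (x + y)
  have hx := curryLeft_same Φ x
  have hy := curryLeft_same Φ y
  simp only [map_add, curryLeft_add, LinearMap.add_apply, hx, hy] at h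
  rw [eq_neg_iff_add_eq_zero]
  simpa [contract] using h

theorem cochain_ext {Φ Ψ : V [⋀^Fin (n + 1)]→ₗ[ℝ] ℝ}
    (h : ∀ x, contract n x Φ = contract n x Ψ) : Φ = Ψ := by
  ext v
  have := congrArg (fun f => f (Fin.tail v)) (h (v 0))
  simpa [contract, Matrix.vecCons] using this

theorem lieDeriv_succ_apply (x : V) (Φ : V [⋀^Fin (n + 1)]→ₗ[ℝ] ℝ) :
    lieDeriv br (n + 1) x Φ = -alternatizeUncurryFin ((contract n).flip Φ ∘ₗ br x) := rfl

theorem ceDiff_apply (Φ : V [⋀^Fin n]→ₗ[ℝ] ℝ) :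
    ceDiff br n Φ = (1 / 2 : ℝ) • alternatizeUncurryFin ((lieDeriv br n).flip Φ) := rfl

/-- The commutation rule `[L_x, ι_y] = ι_[x,y]`. -/
theorem contract_lieDeriv (x y : V) (Φ : V [⋀^Fin (n + 1)]→ₗ[ℝ] ℝ) :
    contract n y (lieDeriv br (n + 1) x Φ)
      = lieDeriv br n x (contract n y Φ) - contract n (br x y) Φ := by
  cases n with
  | zero =>
    ext v
    simp [lieDeriv, contract, alternatizeUncurryFin_apply]
  | succ n =>
    rw [lieDeriv_succ_apply, map_neg, contract_alternatizeUncurryFin, lieDeriv_succ_apply]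
    have h : contract n y ∘ₗ ((contract (n + 1)).flip Φ ∘ₗ br x)
        = -((contract n).flip (contract (n + 1) y Φ) ∘ₗ br x) := by
      ext1 z
      simp [contract_swap y]
    rw [h, alternatizeUncurryFin_neg]
    simp
    abel

theorem lieDeriv_comm (jac : ∀ x y z, br x (br y z) - br y (br x z) = br (br x y) z)
    (x y : V) (Φ : V [⋀^Fin n]→ₗ[ℝ] ℝ) :
    lieDeriv br n x (lieDeriv br n y Φ) - lieDeriv br n y (lieDeriv br n x Φ)
      = lieDeriv br n (br x y) Φ := by
  induction n with
  | zero => simp [lieDeriv]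
  | succ n ih =>
    refine cochain_ext fun z => ?_
    simp only [map_sub, contract_lieDeriv, ← ih, ← jac, LinearMap.sub_apply]
    abel

/-- Cartan's formula `ι_x d = L_x - d ι_x`. -/
theorem contract_ceDiff (alt : ∀ x, br x x = 0) (x : V) (Φ : V [⋀^Fin (n + 1)]→ₗ[ℝ] ℝ) :
    contract (n + 1) x (ceDiff br (n + 1) Φ)
      = lieDeriv br (n + 1) x Φ - ceDiff br n (contract n x Φ) := by
  have hsk : ∀ y, br y x = -br x y := fun y => (LinearMap.IsAlt.neg (B := br) alt x y).symm
  have h : contract n x ∘ₗ (lieDeriv br (n + 1)).flip Φ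
      = (lieDeriv br n).flip (contract n x Φ) + (contract n).flip Φ ∘ₗ br x := by
    ext1 y
    simp [contract_lieDeriv, hsk y]
  rw [ceDiff_apply, map_smul, contract_alternatizeUncurryFin, h, alternatizeUncurryFin_add,
    ceDiff_apply, LinearMap.flip_apply, ← neg_eq_iff_eq_neg.mpr (lieDeriv_succ_apply br x Φ)]
  module

theorem ceDiff_zero : ceDiff br 0 = 0 := by
  ext1 Φ
  rw [ceDiff_apply]
  have : (lieDeriv br 0).flip Φ = 0 := by ext1; simp [lieDeriv]
  rw [this]
  simpa using map_zero (alternatizeUncurryFinLM (R := ℝ) (M := V) (N := ℝ) (n := 0))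

theorem ceDiff_lieDeriv (alt : ∀ x, br x x = 0)
    (jac : ∀ x y z, br x (br y z) - br y (br x z) = br (br x y) z)
    (x : V) (Φ : V [⋀^Fin n]→ₗ[ℝ] ℝ) :
    ceDiff br n (lieDeriv br n x Φ) = lieDeriv br (n + 1) x (ceDiff br n Φ) := by
  induction n with
  | zero => simp [ceDiff_zero]
  | succ n ih =>
    refine cochain_ext fun y => ?_
    simp only [contract_ceDiff br alt, contract_lieDeriv, map_sub, ih, ← lieDeriv_comm br jac]
    abel

theorem ceDiff_ceDiff (alt : ∀ x, br x x = 0)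
    (jac : ∀ x y z, br x (br y z) - br y (br x z) = br (br x y) z)
    (Φ : V [⋀^Fin n]→ₗ[ℝ] ℝ) :
    ceDiff br (n + 1) (ceDiff br n Φ) = 0 := by
  induction n with
  | zero => simp [ceDiff_zero]
  | succ n ih =>
    refine cochain_ext fun x => ?_
    simp only [contract_ceDiff br alt, map_sub, ih, ceDiff_lieDeriv br alt jac]
    simp

theorem ceDfun_eq_ceDiff (alt : ∀ x, br x x = 0) (Φ : V [⋀^Fin n]→ₗ[ℝ] ℝ) :
    ceDfun br (0 : V →ₗ[ℝ] ℝ →ₗ[ℝ] ℝ) Φ = ⇑(ceDiff br n Φ) := by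
  cases n with
  | zero =>
    funext X
    simp [ceDiff_zero, ceDfun]
  | succ n =>
    have hsk : ∀ x y, br y x = -br x y := fun x y => (LinearMap.IsAlt.neg (B := br) alt x y).symm
    funext X
    have h : (lieDeriv br (n + 1)).flip Φ
        = -(alternatizeUncurryFinLM ∘ₗ (br.compr₂ ((contract n).flip Φ))) := by
      ext1 x
      rfl
    rw [ceDiff_apply, h, alternatizeUncurryFin_neg, AlternatingMap.smul_apply, AlternatingMap.neg_apply,
      alternatizeUncurryFin_alternatizeUncurryFinLM_comp_apply]
    unfold ceDfun
    rw [Fin.sum_univ_castSucc (n := n + 1) (f := fun s => ∑ t, _)]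
    have hlast : ∀ t : Fin (n + 2), ¬ ((Fin.last (n + 1) : Fin (n + 2)) : ℕ) < (t : ℕ) := by
      intro t
      have := t.isLt
      simp only [Fin.val_last]
      omega
    simp only [LinearMap.zero_apply, smul_zero, Finset.sum_const_zero, zero_add, hlast,
      if_false, add_zero]
    rw [← Finset.sum_neg_distrib, Finset.smul_sum]
    refine Finset.sum_congr rfl fun i _ => ?_
    rw [Fin.sum_univ_succ, if_neg (by simp), zero_add, ← Finset.sum_neg_distrib,
      Finset.smul_sum, ← Finset.filter_le_eq_Ici, Finset.sum_filter]
    refine Finset.sum_congr rfl fun j _ => ?_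
    by_cases hij : i ≤ j
    · have hij' : (i : ℕ) ≤ j := hij
      rw [if_pos hij, if_pos (by simp; omega)]
      have harg : (fun k : Fin (n + 1) =>
          if (k : ℕ) = 0 then br (X i.castSucc) (X j.succ)
          else if (k : ℕ) - 1 < (i.castSucc : ℕ) then
            X ⟨(k : ℕ) - 1, by have := k.isLt; omega⟩
          else if (k : ℕ) < (j.succ : ℕ) then X ⟨(k : ℕ), by have := k.isLt; omega⟩
          else X ⟨(k : ℕ) + 1, by have := k.isLt; omega⟩)
          = Matrix.vecCons (br (X i.castSucc) (X j.succ))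
              (j.removeNth (i.castSucc.removeNth X)) := by
        funext k
        refine Fin.cases (by simp) (fun k => ?_) k
        simp only [Fin.val_succ, Matrix.cons_val_succ, Fin.removeNth, Fin.val_castSucc]
        simp only [Fin.succAbove, Fin.lt_def, Fin.val_castSucc]
        split_ifs <;> first | omega | rfl | (simp at *; done) | (simp at *; omega)
      rw [harg]
      simp only [LinearMap.compr₂_apply, hsk (X i.castSucc) (X j.succ), map_neg,
        AlternatingMap.neg_apply]
      simp [contract, pow_succ, ← add_assoc]
      ring
    · have hij' : ¬ (i : ℕ) ≤ j := hij
      rw [if_neg hij, if_neg (by simp; omega)]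

end CartanCalculus

section Betti

variable (br : V →ₗ[ℝ] V →ₗ[ℝ] V)

theorem ceD_eq_altEval_comp (alt : ∀ x, br x x = 0) (n : ℕ) :
    ceD br (0 : V →ₗ[ℝ] ℝ →ₗ[ℝ] ℝ) n = altEval (n + 1) ∘ₗ ceDiff br n :=
  LinearMap.ext fun Φ => ceDfun_eq_ceDiff br alt Φ

theorem altEval_injective (n : ℕ) :
    Function.Injective (altEval n : (V [⋀^Fin n]→ₗ[ℝ] W) →ₗ[ℝ] _) :=
  fun _ _ h => DFunLike.coe_injective h

theorem ceZ_eq_ker (alt : ∀ x, br x x = 0) (n : ℕ) :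
    ceZ br (0 : V →ₗ[ℝ] ℝ →ₗ[ℝ] ℝ) n = LinearMap.ker (ceDiff br n) := by
  rw [ceZ, ceD_eq_altEval_comp br alt,
    LinearMap.ker_comp_of_ker_eq_bot _ (LinearMap.ker_eq_bot.2 (altEval_injective _))]

theorem ceB_succ_eq_range (alt : ∀ x, br x x = 0) (n : ℕ) :
    ceB br (0 : V →ₗ[ℝ] ℝ →ₗ[ℝ] ℝ) (n + 1) = LinearMap.range (ceDiff br n) := by
  rw [ceB, ceD_eq_altEval_comp br alt, LinearMap.range_comp,
    Submodule.comap_map_eq_of_injective (altEval_injective _)]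

/-- Evaluation of alternating maps on all tuples of basis vectors. -/
noncomputable def evalBasis {ι : Type*} (b : Module.Basis ι ℝ V) (n : ℕ) :
    (V [⋀^Fin n]→ₗ[ℝ] ℝ) →ₗ[ℝ] ((Fin n → ι) → ℝ) where
  toFun Φ v := Φ fun i => b (v i)
  map_add' _ _ := rfl
  map_smul' _ _ := rfl

theorem evalBasis_injective {ι : Type*} (b : Module.Basis ι ℝ V) (n : ℕ) :
    Function.Injective (evalBasis b n) :=
  fun _ _ h => b.ext_alternating fun v _ => congrFun h v

theorem finite_cochains [FiniteDimensional ℝ V] (n : ℕ) :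
    Module.Finite ℝ (V [⋀^Fin n]→ₗ[ℝ] ℝ) :=
  Module.Finite.of_injective _ (evalBasis_injective (Module.finBasis ℝ V) n)

theorem Hdim_succ_add [FiniteDimensional ℝ V] (alt : ∀ x, br x x = 0)
    (jac : ∀ x y z, br x (br y z) - br y (br x z) = br (br x y) z) (n : ℕ) :
    Hdim br (0 : V →ₗ[ℝ] ℝ →ₗ[ℝ] ℝ) (n + 1)
      + Module.finrank ℝ (LinearMap.range (ceDiff br n))
      + Module.finrank ℝ (LinearMap.range (ceDiff br (n + 1)))
      = Module.finrank ℝ (V [⋀^Fin (n + 1)]→ₗ[ℝ] ℝ) := by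
  have := finite_cochains (V := V) (n + 1)
  have hle : LinearMap.range (ceDiff br n) ≤ LinearMap.ker (ceDiff br (n + 1)) := by
    rintro _ ⟨Φ, rfl⟩
    exact ceDiff_ceDiff br alt jac Φ
  have h1 := LinearMap.finrank_range_add_finrank_ker (ceDiff br (n + 1))
  rw [← ceZ_eq_ker br alt] at h1 hle
  rw [← ceB_succ_eq_range br alt] at hle ⊢
  have h2 : Hdim br (0 : V →ₗ[ℝ] ℝ →ₗ[ℝ] ℝ) (n + 1)
      + Module.finrank ℝ (ceB br (0 : V →ₗ[ℝ] ℝ →ₗ[ℝ] ℝ) (n + 1))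
      = Module.finrank ℝ (ceZ br (0 : V →ₗ[ℝ] ℝ →ₗ[ℝ] ℝ) (n + 1)) := by
    rw [← (Submodule.comapSubtypeEquivOfLe hle).finrank_eq]
    exact Submodule.finrank_quotient_add_finrank _
  omega

/-- A morphism of brackets pulls back cochains compatibly with the differentials. -/
theorem ceDiff_compLinearMap {br br' : V →ₗ[ℝ] V →ₗ[ℝ] V} (alt : ∀ x, br x x = 0)
    (alt' : ∀ x, br' x x = 0) (e : V →ₗ[ℝ] V) (he : ∀ x y, e (br x y) = br' (e x) (e y))
    {n : ℕ} (Φ : V [⋀^Fin n]→ₗ[ℝ] ℝ) :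
    ceDiff br n (Φ.compLinearMap e) = (ceDiff br' n Φ).compLinearMap e := by
  ext X
  rw [← ceDfun_eq_ceDiff br alt, AlternatingMap.compLinearMap_apply, ← ceDfun_eq_ceDiff br' alt']
  simp only [ceDfun, LinearMap.zero_apply, smul_zero, Finset.sum_const_zero, zero_add,
    AlternatingMap.compLinearMap_apply, apply_ite e, he, Function.comp_apply]

theorem finrank_range_ceDiff_le_of_iso [FiniteDimensional ℝ V] {br br' : V →ₗ[ℝ] V →ₗ[ℝ] V}
    (alt : ∀ x, br x x = 0) (alt' : ∀ x, br' x x = 0) (e : V ≃ₗ[ℝ] V)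
    (he : ∀ x y, e (br x y) = br' (e x) (e y)) (n : ℕ) :
    Module.finrank ℝ (LinearMap.range (ceDiff br n))
      ≤ Module.finrank ℝ (LinearMap.range (ceDiff br' n)) := by
  have := finite_cochains (V := V) (n + 1)
  have h : LinearMap.range (ceDiff br n) ≤ (LinearMap.range (ceDiff br' n)).map
      (AlternatingMap.domLCongr ℝ ℝ (Fin (n + 1)) ℝ e.symm).toLinearMap := by
    rintro _ ⟨Φ, rfl⟩
    refine ⟨_, ⟨Φ.compLinearMap e.symm.toLinearMap, rfl⟩, ?_⟩
    have h := ceDiff_compLinearMap alt alt' e.toLinearMap he (Φ.compLinearMap e.symm.toLinearMap)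
    have hΦ : (Φ.compLinearMap e.symm.toLinearMap).compLinearMap e.toLinearMap = Φ := by
      ext X
      simp
    rw [hΦ] at h
    exact h.symm
  exact (Submodule.finrank_mono h).trans (Submodule.finrank_map_le _ _)

end Betti

/-- A multilinear map on a finite-dimensional space is continuous. -/
theorem continuous_multilinearMap {ι E : Type*} [Fintype ι] [NormedAddCommGroup E]
    [NormedSpace ℝ E] [FiniteDimensional ℝ E] (f : MultilinearMap ℝ (fun _ : ι => E) ℝ) :
    Continuous f := by
  classical
  let b := Module.finBasis ℝ E
  have h : ∀ v : ι → E, f v = ∑ r : ι → Fin (Module.finrank ℝ E),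
      (∏ i, b.coord (r i) (v i)) • f fun i => b (r i) := fun v => by
    conv_lhs => rw [show v = fun i => ∑ j, b.coord j (v i) • b j from
      funext fun i => (b.sum_repr (v i)).symm]
    rw [f.map_sum]
    simp only [f.map_smul_univ]
  rw [show ⇑f = _ from funext h]
  refine continuous_finsetSum _ fun r _ =>
    Continuous.fun_smul (continuous_finsetProd _ fun i _ => ?_) continuous_const
  exact (b.coord (r i)).continuous_of_finiteDimensional.comp (continuous_apply i)

/-- The rank of a pointwise continuous family of linear maps is lower semicontinuous. -/
theorem eventually_finrank_range_le {T A M : Type*} [TopologicalSpace T] [AddCommGroup A]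
    [Module ℝ A] [NormedAddCommGroup M] [NormedSpace ℝ M] [FiniteDimensional ℝ M]
    (F : T → A →ₗ[ℝ] M) {s : Set T} {t₀ : T} (hF : ∀ a, ContinuousWithinAt (fun t => F t a) s t₀) :
    ∀ᶠ t in 𝓝[s] t₀, Module.finrank ℝ (LinearMap.range (F t₀))
      ≤ Module.finrank ℝ (LinearMap.range (F t)) := by
  let b := Module.finBasis ℝ (LinearMap.range (F t₀))
  choose a ha using fun i => (b i).2
  have hli : LinearIndependent ℝ fun i => F t₀ (a i) := by
    simp only [ha]
    exact b.linearIndependent.map' _ (Submodule.ker_subtype _)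
  have hc : ContinuousWithinAt (fun t i => F t (a i)) s t₀ :=
    continuousWithinAt_pi.2 fun i => hF (a i)
  filter_upwards [hc.eventually hli.eventually] with t ht
  have h : LinearIndependent ℝ fun i => (⟨F t (a i), a i, rfl⟩ : LinearMap.range (F t)) :=
    LinearIndependent.of_comp (LinearMap.range (F t)).subtype ht
  simpa using h.fintype_card_le_finrank

end CE

namespace LieBracketOn

theorem leibniz {V : Type} [AddCommGroup V] [Module ℝ V] (μ : LieBracketOn V) (x y z : V) :
    μ.br x (μ.br y z) - μ.br y (μ.br x z) = μ.br (μ.br x y) z := by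
  have hsk : ∀ x y, μ.br y x = -μ.br x y := fun x y => (LinearMap.IsAlt.neg (B := μ.br) μ.alt x y).symm
  have h := μ.jacobi x y z
  rw [hsk x z, hsk (μ.br x y) z, map_neg] at h
  rw [← sub_eq_zero, ← h]
  abel

end LieBracketOn

open CE in
/-- The rank of the Chevalley–Eilenberg differential can only go up under a small
deformation of the bracket. -/
theorem eventually_finrank_range_ceDiff_le [FiniteDimensional ℝ V] {T : Type*}
    [TopologicalSpace T] (μt : T → LieBracketOn V) {s : Set T} {t₀ : T}
    (hμ : ∀ X Y : V, ContinuousWithinAt (fun t => (μt t).br X Y) s t₀) (n : ℕ) :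
    ∀ᶠ t in 𝓝[s] t₀, Module.finrank ℝ (LinearMap.range (ceDiff (μt t₀).br n))
      ≤ Module.finrank ℝ (LinearMap.range (ceDiff (μt t).br n)) := by
  let b := Module.finBasis ℝ V
  have key := eventually_finrank_range_le
    (fun t => evalBasis b (n + 1) ∘ₗ ceDiff (μt t).br n) (s := s) (t₀ := t₀) ?_
  · have hr : ∀ t, Module.finrank ℝ (LinearMap.range (evalBasis b (n + 1) ∘ₗ ceDiff (μt t).br n))
        = Module.finrank ℝ (LinearMap.range (ceDiff (μt t).br n)) := fun t => by
      rw [LinearMap.range_comp]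
      exact (Submodule.equivMapOfInjective _ (evalBasis_injective b (n + 1)) _).finrank_eq.symm
    simpa only [hr] using key
  intro Φ
  refine continuousWithinAt_pi.2 fun v => ?_
  change ContinuousWithinAt (fun t => ceDiff (μt t).br n Φ fun i => b (v i)) s t₀
  simp only [← ceDfun_eq_ceDiff _ (μt _).alt, ceDfun]
  simp only [LinearMap.zero_apply, smul_zero, Finset.sum_const_zero, zero_add]
  refine tendsto_finsetSum _ fun i _ => tendsto_finsetSum _ fun j _ => ?_
  split_ifs
  · refine ((continuous_multilinearMap Φ.toMultilinearMap).continuousAt.comp_continuousWithinAt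
      (continuousWithinAt_pi.2 fun k => ?_)).const_smul ((-1 : ℝ) ^ ((i : ℕ) + (j : ℕ)))
    split_ifs
    · exact hμ _ _
    all_goals exact continuousWithinAt_const
  · exact continuousWithinAt_const

open CE Polynomial in
/-- If the difference of Poincaré polynomials
`P_T(g') − P_T(g) = Σ_{i=1}^{dim V} (b_i(g') − b_i(g)) T^i`
(with `b_i = dim H^i(·,ℝ)`) has at least one negative coefficient, then there is
no plateau deformation from `g' = (V,μ')` to `g = (V,μ)`. -/
theorem no_plateau_deformation_of_negative_poincare_coefficient [FiniteDimensional ℝ V]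
    (μ μ' : LieBracketOn V)
    (hneg : ∃ k : ℕ,
      (∑ i ∈ Finset.Icc 1 (Module.finrank ℝ V),
        (C ((Hdim μ'.br (0 : V →ₗ[ℝ] ℝ →ₗ[ℝ] ℝ) i : ℤ)
            - (Hdim μ.br (0 : V →ₗ[ℝ] ℝ →ₗ[ℝ] ℝ) i : ℤ)) * X ^ i : Polynomial ℤ)).coeff k < 0) :
    ¬ ∃ μt : ℝ → LieBracketOn V, IsPlateauDeformation μ' μ μt := by
  rintro ⟨μt, hcont, h0, hiso, -⟩
  obtain ⟨k, hk⟩ := hneg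
  simp only [finsetSum_coeff, coeff_C_mul_X_pow, Finset.sum_ite_eq] at hk
  split_ifs at hk with hmem
  swap
  · exact lt_irrefl _ hk
  obtain ⟨n, rfl⟩ : ∃ n, k = n + 1 := ⟨k - 1, by have := (Finset.mem_Icc.1 hmem).1; omega⟩
  have hrank : ∀ p, Module.finrank ℝ (LinearMap.range (ceDiff μ'.br p))
      ≤ Module.finrank ℝ (LinearMap.range (ceDiff μ.br p)) := by
    intro p
    have hev : ∀ᶠ t in 𝓝[Ioc (0 : ℝ) 1] 0, Module.finrank ℝ (LinearMap.range (ceDiff (μt 0).br p))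
        ≤ Module.finrank ℝ (LinearMap.range (ceDiff (μt t).br p)) :=
      eventually_finrank_range_ceDiff_le μt (fun X Y =>
        (hcont X Y 0 (left_mem_Icc.2 zero_le_one)).mono Ioc_subset_Icc_self) p
    have : (𝓝[Ioc (0 : ℝ) 1] 0).NeBot := by
      rw [nhdsWithin_Ioc_eq_nhdsGT zero_lt_one]
      infer_instance
    obtain ⟨t, ht, htI⟩ := (hev.and self_mem_nhdsWithin).exists
    obtain ⟨e, he⟩ := hiso t htI
    rw [h0] at ht
    exact ht.trans (finrank_range_ceDiff_le_of_iso (μt t).alt μ.alt e he p)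
  have h1 := Hdim_succ_add μ.br μ.alt μ.leibniz n
  have h2 := Hdim_succ_add μ'.br μ'.alt μ'.leibniz n
  have h3 := hrank n
  have h4 := hrank (n + 1)
  omega
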